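/- Let μ be a probability distribution on the k-element subsets of [n] whose generating polynomial g_μ is log-concave, let p : [n] → ℝ_{>0} be any positive function, let t ≥ k be an integer, and let τ = (τ₁,…,τ_t) ∈ [n]^t be any sequence. Then ∑_{S ∈ binom([t],k)} μ(τ_S) · ∏_{i∈S} p(τ_i)^{−1} ≤ ( ∑_{i=1}^t P_{S∼μ}[τ_i ∈ S] / (k · p(τ_i)) )^k, where for an index set S ⊆ [t], τ_S denotes the set {τ_i : i ∈ S} (so μ(τ_S) = 0 whenever τ is not injective on S, since then |τ_S| < k). -/

import Mathlib

open Finset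

/-- A probability distribution on the `k`-element subsets of `[n]`:
nonnegative, supported on `k`-element sets, summing to `1`. -/
def IsProbDistOn (n k : ℕ) (μ : Finset (Fin n) → ℝ) : Prop :=
  (∀ S, 0 ≤ μ S) ∧ (∀ S, S.card ≠ k → μ S = 0) ∧ (∑ S : Finset (Fin n), μ S = 1)

/-- The generating polynomial `g_μ(z) = ∑_{|S|=k} μ(S) ∏_{i∈S} z_i`. -/
noncomputable def genPoly (n k : ℕ) (μ : Finset (Fin n) → ℝ) (z : Fin n → ℝ) : ℝ :=
  ∑ S ∈ Finset.univ.filter (fun S : Finset (Fin n) => S.card = k), μ S * ∏ i ∈ S, z i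

/-- `g` is log-concave as a function on `ℝ_{≥0}^n`. -/
def IsLogConcaveOn (n : ℕ) (g : (Fin n → ℝ) → ℝ) : Prop :=
  ∀ x y : Fin n → ℝ, (∀ i, 0 ≤ x i) → (∀ i, 0 ≤ y i) →
    ∀ lam : ℝ, 0 < lam → lam < 1 →
      g x ^ lam * g y ^ (1 - lam) ≤ g (fun i => lam * x i + (1 - lam) * y i)

/-- The marginal `P_{S∼μ}[i ∈ S]`. -/
noncomputable def marginal (n : ℕ) (μ : Finset (Fin n) → ℝ) (i : Fin n) : ℝ :=
  ∑ S ∈ Finset.univ.filter (fun S : Finset (Fin n) => i ∈ S), μ S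

/-- Expanding a product of fibre sums of `τ` over a finite set `T` gives the sum over the
transversals, i.e. over the sets mapped bijectively onto `T` by `τ`. -/
theorem prod_sum_fiber_eq_sum_transversals {ι κ : Type*} [Fintype ι] [DecidableEq ι]
    [DecidableEq κ] (τ : ι → κ) (a : ι → ℝ) (T : Finset κ) :
    ∏ j ∈ T, ∑ i ∈ univ.filter (fun i => τ i = j), a i
      = ∑ S ∈ univ.filter (fun S : Finset ι => S.card = T.card ∧ S.image τ = T),
          ∏ i ∈ S, a i := by
  rw [Finset.prod_sum]
  have section_of : ∀ φ ∈ T.pi (fun j => univ.filter (fun i => τ i = j)),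
      ∀ j (hj : j ∈ T), τ (φ j hj) = j := by
    intro φ hφ j hj
    simpa using Finset.mem_pi.1 hφ j hj
  have injective_of : ∀ φ ∈ T.pi (fun j => univ.filter (fun i => τ i = j)),
      Function.Injective (fun x : T => φ x.1 x.2) := by
    intro φ hφ x y hxy
    have h := congrArg τ hxy
    simp only [section_of φ hφ] at h
    exact Subtype.ext h
  refine Finset.sum_bij (fun φ _ => T.attach.image (fun x => φ x.1 x.2)) ?_ ?_ ?_ ?_
  · intro φ hφ
    simp only [mem_filter, mem_univ, true_and]
    refine ⟨by rw [card_image_of_injective _ (injective_of φ hφ), card_attach], ?_⟩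
    rw [image_image]
    ext j
    simp [section_of φ hφ]
  · intro φ hφ ψ hψ h
    funext j hj
    have hmem : φ j hj ∈ T.attach.image (fun x => ψ x.1 x.2) := by
      rw [← h]
      exact mem_image_of_mem (fun x : T => φ x.1 x.2) (mem_attach T ⟨j, hj⟩)
    obtain ⟨⟨l, hl⟩, -, hlj⟩ := mem_image.1 hmem
    have hτ := congrArg τ hlj
    simp only [section_of φ hφ, section_of ψ hψ] at hτ
    subst hτ
    exact hlj.symm
  · intro S hS
    simp only [mem_filter, mem_univ, true_and] at hS
    obtain ⟨hcard, himg⟩ := hS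
    have hex : ∀ j ∈ T, ∃ i ∈ S, τ i = j := by
      intro j hj
      rw [← himg] at hj
      simpa using hj
    choose φ hφS hφτ using hex
    have hφ : φ ∈ T.pi (fun j => univ.filter (fun i => τ i = j)) := by
      simp [Finset.mem_pi, hφτ]
    refine ⟨φ, hφ, Finset.eq_of_subset_of_card_le ?_ ?_⟩
    · intro i hi
      obtain ⟨x, -, rfl⟩ := mem_image.1 hi
      exact hφS _ _
    · rw [card_image_of_injective _ (injective_of φ hφ), card_attach, hcard]
  · intro φ hφ
    rw [prod_image (fun x _ y _ h => injective_of φ hφ h)]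

/-- Pulling a distribution on `k`-sets back along a sequence `τ` evaluates its generating
polynomial at the fibre sums of the weights. -/
theorem sum_image_eq_genPoly {n k t : ℕ} {μ : Finset (Fin n) → ℝ}
    (hμ : ∀ S, S.card ≠ k → μ S = 0) (τ : Fin t → Fin n) (a : Fin t → ℝ) :
    ∑ S ∈ univ.filter (fun S : Finset (Fin t) => S.card = k), μ (S.image τ) * ∏ i ∈ S, a i
      = genPoly n k μ (fun j => ∑ i ∈ univ.filter (fun i => τ i = j), a i) := by
  rw [genPoly, sum_filter (fun S : Finset (Fin n) => S.card = k),
    ← Finset.sum_fiberwise _ (fun S : Finset (Fin t) => S.image τ)]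
  refine Finset.sum_congr rfl fun T _ => ?_
  split_ifs with hT
  · rw [prod_sum_fiber_eq_sum_transversals, mul_sum, filter_filter, hT]
    refine Finset.sum_congr rfl fun S hS => ?_
    rw [(mem_filter.1 hS).2.2]
  · refine Finset.sum_eq_zero fun S hS => ?_
    rw [(mem_filter.1 hS).2, hμ T hT, zero_mul]

/-- A function vanishing at `0` and nonnegative on `(0, 1)` has nonnegative derivative at `0`. -/
theorem HasDerivAt.nonneg_of_nonneg_Ioo {h : ℝ → ℝ} {d : ℝ} (hd : HasDerivAt h d 0)
    (h0 : h 0 = 0) (hpos : ∀ s ∈ Set.Ioo (0 : ℝ) 1, 0 ≤ h s) : 0 ≤ d := by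
  have hlim := (hasDerivWithinAt_iff_tendsto_slope' (s := Set.Ioi (0 : ℝ)) (by simp)).1
    (hd.hasDerivWithinAt (s := Set.Ioi 0))
  refine ge_of_tendsto hlim ?_
  filter_upwards [Ioo_mem_nhdsGT (zero_lt_one' ℝ)] with s hs
  rw [slope_def_field, h0, sub_zero, sub_zero]
  exact div_nonneg (hpos s hs) hs.1.le

section genPoly

variable {n k : ℕ} {μ : Finset (Fin n) → ℝ}

theorem genPoly_const_mul (c : ℝ) (z : Fin n → ℝ) :
    genPoly n k μ (fun i => c * z i) = c ^ k * genPoly n k μ z := by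
  rw [genPoly, genPoly, mul_sum]
  refine Finset.sum_congr rfl fun S hS => ?_
  rw [prod_mul_distrib, prod_const, (mem_filter.1 hS).2]
  ring

theorem genPoly_nonneg (hμ : ∀ S, 0 ≤ μ S) {z : Fin n → ℝ} (hz : ∀ i, 0 ≤ z i) :
    0 ≤ genPoly n k μ z :=
  Finset.sum_nonneg fun S _ => mul_nonneg (hμ S) (Finset.prod_nonneg fun i _ => hz i)

theorem IsProbDistOn.genPoly_one (hμ : IsProbDistOn n k μ) :
    genPoly n k μ (fun _ => 1) = 1 := by
  rw [genPoly, sum_filter]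
  refine Eq.trans ?_ hμ.2.2
  refine Finset.sum_congr rfl fun S _ => ?_
  split_ifs with hS
  · simp
  · exact (hμ.2.1 S hS).symm

theorem sum_marginal_mul (v : Fin n → ℝ) :
    ∑ j, marginal n μ j * v j = ∑ S : Finset (Fin n), μ S * ∑ j ∈ S, v j := by
  simp_rw [marginal, sum_filter, sum_mul, mul_sum]
  rw [Finset.sum_comm]
  refine Finset.sum_congr rfl fun S _ => ?_
  simp [ite_mul]

theorem IsProbDistOn.sum_marginal (hμ : IsProbDistOn n k μ) :
    ∑ j, marginal n μ j = k := by
  have h := sum_marginal_mul (μ := μ) (fun _ => 1)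
  simp only [mul_one] at h
  have hcard : ∀ S, μ S * ∑ j ∈ S, (1 : ℝ) = μ S * k := by
    intro S
    by_cases hS : S.card = k
    · simp [hS]
    · simp [hμ.2.1 S hS]
  rw [h, Finset.sum_congr rfl fun S _ => hcard S, ← sum_mul, hμ.2.2, one_mul]

theorem IsProbDistOn.hasDerivAt_genPoly_line (hμ : IsProbDistOn n k μ) (v : Fin n → ℝ) :
    HasDerivAt (fun s : ℝ => genPoly n k μ (fun i => 1 + s * v i))
      (∑ j, marginal n μ j * v j) 0 := by
  have hsum : ∑ j, marginal n μ j * v j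
      = ∑ S ∈ univ.filter (fun S : Finset (Fin n) => S.card = k), μ S * ∑ j ∈ S, v j := by
    rw [sum_marginal_mul, sum_filter]
    refine Finset.sum_congr rfl fun S _ => ?_
    split_ifs with hS
    · rfl
    · rw [hμ.2.1 S hS, zero_mul]
  rw [hsum]
  unfold genPoly
  refine HasDerivAt.fun_sum fun S _ => HasDerivAt.const_mul _ ?_
  have hprod := HasDerivAt.fun_finsetProd (u := S) (x := (0 : ℝ))
    (f := fun i s => 1 + s * v i) (f' := v)
    (fun i _ => by simpa using ((hasDerivAt_id (0 : ℝ)).mul_const (v i)).const_add 1)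
  simpa using hprod

/-- The tangent inequality for `log g` at the all-ones point. -/
theorem IsProbDistOn.log_genPoly_le (hμ : IsProbDistOn n k μ)
    (hlc : IsLogConcaveOn n (genPoly n k μ)) {w : Fin n → ℝ} (hw : ∀ i, 0 ≤ w i)
    (hpos : 0 < genPoly n k μ w) :
    Real.log (genPoly n k μ w) ≤ ∑ j, marginal n μ j * w j - k := by
  have hexp : HasDerivAt (fun s : ℝ => genPoly n k μ w ^ s) (Real.log (genPoly n k μ w)) 0 := by
    simpa using (hasDerivAt_id (0 : ℝ)).const_rpow hpos
  have h := ((hμ.hasDerivAt_genPoly_line (fun i => w i - 1)).fun_sub hexp).nonneg_of_nonneg_Ioo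
    (by simp [hμ.genPoly_one]) (fun s hs => by
      have hline := hlc w (fun _ => 1) hw (fun _ => zero_le_one) s hs.1 hs.2
      rw [hμ.genPoly_one, Real.one_rpow, mul_one] at hline
      rw [sub_nonneg]
      convert hline using 2
      funext i
      ring)
  simp only [mul_sub, mul_one, sum_sub_distrib, hμ.sum_marginal] at h
  linarith

/-- A log-concave generating polynomial is bounded by the `k`-th power of its normalised
linearisation at the all-ones point. -/
theorem IsProbDistOn.genPoly_le_pow (hk : 1 ≤ k) (hμ : IsProbDistOn n k μ)
    (hlc : IsLogConcaveOn n (genPoly n k μ)) {w : Fin n → ℝ} (hw : ∀ i, 0 ≤ w i) :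
    genPoly n k μ w ≤ ((∑ j, marginal n μ j * w j) / k) ^ k := by
  have hk0 : (0 : ℝ) < k := by exact_mod_cast hk
  have hM : 0 ≤ ∑ j, marginal n μ j * w j :=
    Finset.sum_nonneg fun j _ => mul_nonneg (Finset.sum_nonneg fun S _ => hμ.1 S) (hw j)
  set M := ∑ j, marginal n μ j * w j
  rcases (genPoly_nonneg hμ.1 hw : 0 ≤ genPoly n k μ w).eq_or_lt with h0 | hpos
  · rw [← h0]
    positivity
  have hscale : ∀ c : ℝ, 0 < c → k * Real.log c + Real.log (genPoly n k μ w) ≤ c * M - k := by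
    intro c hc
    have h := hμ.log_genPoly_le hlc (w := fun i => c * w i) (fun i => mul_nonneg hc.le (hw i))
      (by rw [genPoly_const_mul]; positivity)
    rw [genPoly_const_mul, Real.log_mul (by positivity) hpos.ne', Real.log_pow] at h
    simp only [mul_left_comm _ c, ← mul_sum] at h
    exact h
  rcases hM.eq_or_lt with hM0 | hMpos
  · have h := hscale (Real.exp (-Real.log (genPoly n k μ w) / k)) (Real.exp_pos _)
    rw [Real.log_exp, ← hM0, mul_div_cancel₀ _ hk0.ne'] at h
    linarith
  · have h := hscale (k / M) (by positivity)
    rw [div_mul_cancel₀ _ hMpos.ne', ← inv_div, Real.log_inv] at h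
    refine (Real.log_le_log_iff hpos (by positivity)).1 ?_
    rw [Real.log_pow]
    linarith

end genPoly

theorem negative_dependence_inequality
    (n k t : ℕ) (hk : 1 ≤ k) (hkn : k ≤ n) (ht : k ≤ t)
    (μ : Finset (Fin n) → ℝ) (hμ : IsProbDistOn n k μ)
    (hlc : IsLogConcaveOn n (genPoly n k μ))
    (p : Fin n → ℝ) (hp : ∀ i, 0 < p i)
    (τ : Fin t → Fin n) :
    (∑ S ∈ Finset.univ.filter (fun S : Finset (Fin t) => S.card = k),
        μ (S.image τ) * ∏ i ∈ S, (p (τ i))⁻¹)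
      ≤ (∑ i : Fin t, marginal n μ (τ i) / ((k : ℝ) * p (τ i))) ^ k := by
  rw [sum_image_eq_genPoly hμ.2.1 τ (fun i => (p (τ i))⁻¹)]
  refine (hμ.genPoly_le_pow hk hlc
    (fun j => Finset.sum_nonneg fun i _ => (inv_pos.2 (hp (τ i))).le)).trans_eq ?_
  congr 1
  rw [← Finset.sum_fiberwise univ τ, sum_div]
  refine Finset.sum_congr rfl fun j _ => ?_
  rw [mul_sum, sum_div]
  refine Finset.sum_congr rfl fun i hi => ?_
  rw [(mem_filter.1 hi).2, ← div_eq_mul_inv, div_div, mul_comm (p j)]
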